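/- arXiv:1804.01504 — 2 statements merged into one kernel-verified Lean document; each statement's English description precedes it below -/
import Mathlib

section
/- Let (μ_i^{(k)})_{1≤i≤k≤n} be a triangular array of real numbers satisfying the interlacing inequalities μ_i^{(k)} ≥ μ_i^{(k−1)} ≥ μ_{i+1}^{(k)} for all 1 ≤ i < k ≤ n. Then there exists an n×n Hermitian matrix A with λ_i^{(k)}(A) = μ_i^{(k)} for all 1 ≤ i ≤ k ≤ n. Consequently, the image of the Gelfand–Zeitlin map A ↦ (λ_i^{(k)}(A)) is exactly the polyhedral cone cut out by the interlacing inequalities. -/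
open Matrix Finset Filter

noncomputable section

/-- Bottom-right `k × k` principal submatrix of an `n × n` matrix. -/
def corner (n k : ℕ) (hk : k ≤ n) (X : Matrix (Fin n) (Fin n) ℂ) :
    Matrix (Fin k) (Fin k) ℂ :=
  Matrix.of fun i j =>
    X ⟨n - k + i.val, by have := i.isLt; omega⟩ ⟨n - k + j.val, by have := j.isLt; omega⟩

theorem corner_isHermitian {n k : ℕ} (hk : k ≤ n) {A : Matrix (Fin n) (Fin n) ℂ}
    (hA : A.IsHermitian) : (corner n k hk A).IsHermitian := by
  ext i j
  simpa [corner, Matrix.conjTranspose_apply] using hA.apply _ _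

/-- The eigenvalues of a Hermitian matrix, with multiplicity, sorted in decreasing order:
`sortedEig hB i.rev` is increasing in `i`, so `sortedEig hB 0` is the largest eigenvalue. -/
def sortedEig {k : ℕ} {B : Matrix (Fin k) (Fin k) ℂ} (hB : B.IsHermitian) : Fin k → ℝ :=
  fun i => hB.eigenvalues (Tuple.sort hB.eigenvalues i.rev)

open scoped Classical in
/-- The Gelfand–Zeitlin function `λ_i^{(k)}(A)` (`1 ≤ i ≤ k ≤ n`, one-based indexing):
the `i`-th largest eigenvalue (with multiplicity) of the bottom-right `k × k`
principal submatrix of `A`.  Junk value `0` outside the valid index range or if `A`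
is not Hermitian. -/
def GZ (n : ℕ) (A : Matrix (Fin n) (Fin n) ℂ) (k i : ℕ) : ℝ :=
  if h : A.IsHermitian ∧ 1 ≤ i ∧ i ≤ k ∧ k ≤ n then
    sortedEig (corner_isHermitian h.2.2.2 h.1) ⟨i - 1, by omega⟩
  else 0

/-- `ℓ_i^{(k)}(A) = λ_1^{(k)}(A) + ⋯ + λ_i^{(k)}(A)`; in particular `ellGZ n A k 0 = 0`. -/
def ellGZ (n : ℕ) (A : Matrix (Fin n) (Fin n) ℂ) (k i : ℕ) : ℝ :=
  ∑ j ∈ Finset.Icc 1 i, GZ n A k j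

/-- The set `AN` of upper triangular complex matrices with positive real diagonal entries. -/
def AN (n : ℕ) : Set (Matrix (Fin n) (Fin n) ℂ) :=
  {b | (∀ i j : Fin n, j < i → b i j = 0) ∧ ∀ i : Fin n, 0 < (b i i).re ∧ (b i i).im = 0}

/-- The corner minor `Δ_i^{(k)}(b)`: determinant of the `i × i` submatrix with
(one-based) rows `n-k+1, …, n-k+i` and columns `n-i+1, …, n`.  Junk value `0`
outside the valid index range. -/
def cornerMinor (n k i : ℕ) (b : Matrix (Fin n) (Fin n) ℂ) : ℂ :=
  if h : 1 ≤ i ∧ i ≤ k ∧ k ≤ n then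
    Matrix.det (Matrix.of fun p q : Fin i =>
      b ⟨n - k + p.val, by have := p.isLt; omega⟩ ⟨n - i + q.val, by have := q.isLt; omega⟩)
  else 0

open scoped Classical in
/-- The minor `det (b_{I,J})` with rows `I` and columns `J` (taken in increasing order);
junk value `0` if `I.card ≠ J.card`. -/
def subMinor {n : ℕ} (b : Matrix (Fin n) (Fin n) ℂ) (I J : Finset (Fin n)) : ℂ :=
  if h : I.card = J.card then
    Matrix.det (Matrix.of fun p q : Fin I.card =>
      b ((I.orderIsoOfFin rfl) p) ((J.orderIsoOfFin h.symm) q))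
  else 0

/-- A triangular array `L k i = ℓ_i^{(k)}` (the convention `ℓ_0^{(k)} = 0` is to be built
into `L`) lies in `C^δ`: the rhombus inequalities hold with margin `δ`. -/
def inCdelta (n : ℕ) (δ : ℝ) (L : ℕ → ℕ → ℝ) : Prop :=
  ∀ i k : ℕ, 1 ≤ i → i ≤ k → k < n →
    L (k+1) i + L k (i-1) > L (k+1) (i-1) + L k i + δ ∧
    L (k+1) i + L k i > L (k+1) (i+1) + L k (i-1) + δ

open Polynomial in
theorem antitone_eq_of_prod_X_sub_C_eq {k : ℕ} {f g : Fin k → ℝ} (hf : Antitone f)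
    (hg : Antitone g)
    (h : ∏ i, (X - C (f i : ℂ)) = ∏ i, (X - C (g i : ℂ))) : f = g := by
  have h' := congrArg Polynomial.roots h
  have hroots : ∀ u : Fin k → ℝ, (∏ i, (X - C (u i : ℂ))).roots =
      Multiset.map (fun i => (u i : ℂ)) univ.val := fun u => by
    rw [← Polynomial.roots_multiset_prod_X_sub_C (Multiset.map _ univ.val), Multiset.map_map]
    rfl
  rw [hroots, hroots] at h'
  have h2 : Multiset.map f univ.val = Multiset.map g univ.val := by
    simpa only [Multiset.map_map, Function.comp_def, Complex.ofReal_re] using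
      congrArg (Multiset.map Complex.re) h'
  rw [Fin.univ_val_map, Fin.univ_val_map, Multiset.coe_eq_coe] at h2
  exact List.ofFn_injective
    (h2.eq_of_pairwise' hf.sortedGE_ofFn.pairwise hg.sortedGE_ofFn.pairwise)

theorem sortedEig_antitone {k : ℕ} {B : Matrix (Fin k) (Fin k) ℂ} (hB : B.IsHermitian) :
    Antitone (sortedEig hB) := fun _ _ hij =>
  Tuple.monotone_sort hB.eigenvalues (Fin.rev_le_rev.2 hij)

theorem exists_unitary_diagonal_sortedEig {k : ℕ} {B : Matrix (Fin k) (Fin k) ℂ}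
    (hB : B.IsHermitian) :
    ∃ U : Matrix (Fin k) (Fin k) ℂ, Uᴴ * U = 1 ∧ U * Uᴴ = 1 ∧
      B = U * diagonal (fun i => (sortedEig hB i : ℂ)) * Uᴴ := by
  let V : Matrix (Fin k) (Fin k) ℂ := (hB.eigenvectorUnitary : Matrix (Fin k) (Fin k) ℂ)
  let e : Fin k ≃ Fin k := Fin.revPerm.trans (Tuple.sort hB.eigenvalues)
  have hd : diagonal (fun i => (sortedEig hB i : ℂ)) =
      (diagonal (fun i => (hB.eigenvalues i : ℂ))).submatrix e e := by
    rw [submatrix_diagonal_equiv]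
    rfl
  refine ⟨V.submatrix id e, ?_, ?_, ?_⟩
  · rw [conjTranspose_submatrix, submatrix_mul _ _ e id e Function.bijective_id |>.symm,
      ← star_eq_conjTranspose, Unitary.coe_star_mul_self, submatrix_one_equiv]
  · rw [conjTranspose_submatrix, submatrix_mul_equiv, submatrix_id_id,
      ← star_eq_conjTranspose]
    exact Unitary.mul_star_self_of_mem hB.eigenvectorUnitary.2
  · rw [hd, conjTranspose_submatrix, submatrix_mul_equiv, submatrix_mul_equiv, submatrix_id_id,
      ← star_eq_conjTranspose]
    exact hB.spectral_theorem

open Polynomial in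
theorem charpoly_eq_prod_sortedEig {k : ℕ} {B : Matrix (Fin k) (Fin k) ℂ} (hB : B.IsHermitian) :
    B.charpoly = ∏ i, (X - C (sortedEig hB i : ℂ)) := by
  obtain ⟨U, hU, -, h⟩ := exists_unitary_diagonal_sortedEig hB
  conv_lhs => rw [h]
  rw [charpoly_mul_comm, ← mul_assoc, hU, one_mul, charpoly_diagonal]

/-- If an isometry `W` compresses `diag α` to `diag β`, then `min_T β ≤ max_S α` for index sets
`S`, `T` large enough to force the corresponding coordinate subspaces to meet. -/
theorem le_of_compression {m k : ℕ} {W : Matrix (Fin m) (Fin k) ℂ} {α : Fin m → ℝ}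
    {β : Fin k → ℝ} (hW : Wᴴ * W = 1)
    (hαβ : Wᴴ * diagonal (fun i => (α i : ℂ)) * W = diagonal (fun i => (β i : ℂ)))
    {S : Finset (Fin m)} {T : Finset (Fin k)} (hST : m < S.card + T.card) {a b : ℝ}
    (ha : ∀ s ∈ S, α s ≤ a) (hb : ∀ t ∈ T, b ≤ β t) : b ≤ a := by
  have key : ∃ x : Fin k → ℂ, x ≠ 0 ∧ (∀ t ∉ T, x t = 0) ∧ ∀ s ∉ S, (W *ᵥ x) s = 0 := by
    let f : (Fin k → ℂ) →ₗ[ℂ] (({t // t ∉ T} → ℂ) × ({s // s ∉ S} → ℂ)) :=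
      (LinearMap.funLeft ℂ ℂ Subtype.val).prod
        ((LinearMap.funLeft ℂ ℂ Subtype.val).comp W.mulVecLin)
    have hf : LinearMap.ker f ≠ ⊥ := by
      apply LinearMap.ker_ne_bot_of_finrank_lt
      have h1 := T.card_le_univ
      have h2 := S.card_le_univ
      simp only [Fintype.card_fin] at h1 h2
      simp only [Module.finrank_prod, Module.finrank_fintype_fun_eq_card,
        Fintype.card_subtype_compl, Fintype.card_fin, Fintype.card_coe]
      omega
    obtain ⟨x, hx, hx0⟩ := Submodule.exists_mem_ne_zero_of_ne_bot hf
    have hx' : f x = 0 := hx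
    refine ⟨x, hx0, fun t ht => ?_, fun s hs => ?_⟩
    · exact congrFun (congrArg Prod.fst hx') ⟨t, ht⟩
    · exact congrFun (congrArg Prod.snd hx') ⟨s, hs⟩
  obtain ⟨x, hx0, hxT, hxS⟩ := key
  have quad : ∀ {l : ℕ} (γ : Fin l → ℝ) (v : Fin l → ℂ),
      star v ⬝ᵥ (diagonal (fun i => (γ i : ℂ)) *ᵥ v) =
        ((∑ i, γ i * Complex.normSq (v i) : ℝ) : ℂ) := by
    intro l γ v
    simp only [dotProduct, mulVec_diagonal, Complex.ofReal_sum, Complex.ofReal_mul,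
      Complex.normSq_eq_conj_mul_self, Pi.star_apply, RCLike.star_def]
    exact Finset.sum_congr rfl fun i _ => by ring
  have transfer : ∀ (γ : Fin m → ℝ) (δ : Fin k → ℝ),
      Wᴴ * diagonal (fun i => (γ i : ℂ)) * W = diagonal (fun i => (δ i : ℂ)) →
      ∑ i, γ i * Complex.normSq ((W *ᵥ x) i) = ∑ i, δ i * Complex.normSq (x i) := by
    intro γ δ h
    have h1 := quad δ x
    rw [← h, ← mulVec_mulVec, ← mulVec_mulVec, dotProduct_mulVec, ← star_mulVec, quad] at h1
    exact_mod_cast h1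
  have h1 := transfer α β hαβ
  have h2 := transfer (fun _ => 1) (fun _ => 1) (by simpa using hW)
  simp only [one_mul] at h2
  have h3 : 0 < ∑ i, Complex.normSq (x i) := by
    obtain ⟨i, hi⟩ := Function.ne_iff.1 hx0
    exact Finset.sum_pos' (fun i _ => Complex.normSq_nonneg _)
      ⟨i, mem_univ _, Complex.normSq_pos.2 hi⟩
  have h4 : b * ∑ i, Complex.normSq (x i) ≤ ∑ i, β i * Complex.normSq (x i) := by
    rw [Finset.mul_sum]
    refine Finset.sum_le_sum fun t _ => ?_
    by_cases ht : t ∈ T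
    · exact mul_le_mul_of_nonneg_right (hb t ht) (Complex.normSq_nonneg _)
    · simp [hxT t ht]
  have h5 : ∑ i, α i * Complex.normSq ((W *ᵥ x) i) ≤ a * ∑ i, Complex.normSq (x i) := by
    rw [← h2, Finset.mul_sum]
    refine Finset.sum_le_sum fun s _ => ?_
    by_cases hs : s ∈ S
    · exact mul_le_mul_of_nonneg_right (ha s hs) (Complex.normSq_nonneg _)
    · simp [hxS s hs]
  exact le_of_mul_le_mul_right (h4.trans (h1 ▸ h5)) h3

/-- Cauchy's interlacing theorem. -/
theorem sortedEig_interlace {k : ℕ} {A : Matrix (Fin (k + 1)) (Fin (k + 1)) ℂ}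
    (hA : A.IsHermitian) {B : Matrix (Fin k) (Fin k) ℂ} (hB : B.IsHermitian)
    (hAB : A.submatrix Fin.succ Fin.succ = B) (i : Fin k) :
    sortedEig hB i ≤ sortedEig hA i.castSucc ∧ sortedEig hA i.succ ≤ sortedEig hB i := by
  obtain ⟨U, hU, hU', hUA⟩ := exists_unitary_diagonal_sortedEig hA
  obtain ⟨V, hV, hV', hVB⟩ := exists_unitary_diagonal_sortedEig hB
  set α := sortedEig hA
  set β := sortedEig hB
  let E : Matrix (Fin (k + 1)) (Fin k) ℂ := (1 : Matrix _ _ ℂ).submatrix id Fin.succ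
  have hE : Eᴴ * E = 1 := by
    rw [conjTranspose_submatrix, ← submatrix_mul _ _ _ id _ Function.bijective_id]
    simp [submatrix_one _ (Fin.succ_injective k)]
  have hEA : Eᴴ * A * E = B := by
    rw [← hAB]
    ext i j
    simp [E, Matrix.mul_apply, Matrix.one_apply]
  have hW : (Uᴴ * E * V)ᴴ * (Uᴴ * E * V) = 1 := by
    calc (Uᴴ * E * V)ᴴ * (Uᴴ * E * V) = Vᴴ * (Eᴴ * (U * Uᴴ) * E) * V := by
          simp [Matrix.mul_assoc]
      _ = 1 := by rw [hU', Matrix.mul_one, hE, Matrix.mul_one, hV]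
  have hD : (Uᴴ * E * V)ᴴ * diagonal (fun i => (α i : ℂ)) * (Uᴴ * E * V) =
      diagonal (fun i => (β i : ℂ)) := by
    calc (Uᴴ * E * V)ᴴ * diagonal (fun i => (α i : ℂ)) * (Uᴴ * E * V)
        = Vᴴ * (Eᴴ * (U * diagonal (fun i => (α i : ℂ)) * Uᴴ) * E) * V := by
          simp [Matrix.mul_assoc]
      _ = (Vᴴ * V) * diagonal (fun i => (β i : ℂ)) * (Vᴴ * V) := by
          rw [← hUA, hEA, hVB]
          simp only [Matrix.mul_assoc]
      _ = _ := by rw [hV, one_mul, mul_one]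
  constructor
  · refine le_of_compression hW hD (S := Finset.Ici i.castSucc) (T := Finset.Iic i) ?_
      (fun s hs => sortedEig_antitone hA (Finset.mem_Ici.1 hs))
      (fun t ht => sortedEig_antitone hB (Finset.mem_Iic.1 ht))
    simp only [Fin.card_Ici, Fin.card_Iic, Fin.val_castSucc]
    omega
  · have hD' : (Uᴴ * E * V)ᴴ * diagonal (fun i => ((-α i : ℝ) : ℂ)) * (Uᴴ * E * V) =
        diagonal (fun i => ((-β i : ℝ) : ℂ)) := by
      have h : ∀ {l : ℕ} (γ : Fin l → ℝ), diagonal (fun i => ((-γ i : ℝ) : ℂ)) =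
          -diagonal (fun i => (γ i : ℂ)) := by
        intro l γ
        rw [diagonal_neg]
        congr 1
        ext i
        simp
      rw [h, h, Matrix.mul_neg, Matrix.neg_mul, hD]
    refine neg_le_neg_iff.1 (le_of_compression hW hD' (S := Finset.Iic i.succ)
      (T := Finset.Ici i) ?_
      (fun s hs => neg_le_neg (sortedEig_antitone hA (Finset.mem_Iic.1 hs)))
      (fun t ht => neg_le_neg (sortedEig_antitone hB (Finset.mem_Ici.1 ht))))
    simp only [Fin.card_Ici, Fin.card_Iic, Fin.val_succ]
    omega

theorem residue_nonneg {k : ℕ} {d : Fin k → ℝ} {l : Fin (k + 1) → ℝ} (hd : StrictAnti d)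
    (hl : ∀ i : Fin k, d i ≤ l i.castSucc ∧ l i.succ ≤ d i) (i : Fin k) :
    0 ≤ -((∏ j ∈ univ.erase i, (d i - d j)⁻¹) * ∏ j, (d i - l j)) := by
  rw [Fin.prod_univ_succAbove _ i.castSucc, ← Finset.mul_prod_erase univ _ (mem_univ i),
    Fin.succAbove_castSucc_self]
  have h : 0 ≤ ∏ j ∈ univ.erase i, ((d i - d j)⁻¹ * (d i - l (i.castSucc.succAbove j))) := by
    refine Finset.prod_nonneg fun j hj => ?_
    rcases lt_or_gt_of_ne (Finset.ne_of_mem_erase hj) with hji | hij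
    · rw [Fin.succAbove_of_castSucc_lt _ _ (by simpa using hji)]
      have h1 := hd hji
      exact mul_nonneg_of_nonpos_of_nonpos (inv_nonpos.2 (by linarith))
        (by linarith [(hl j).1])
    · rw [Fin.succAbove_of_le_castSucc _ _ (by simpa using hij.le)]
      have h1 := hd hij
      exact mul_nonneg (inv_nonneg.2 (by linarith)) (by linarith [(hl j).2])
  rw [Finset.prod_mul_distrib] at h
  have h1 : 0 ≤ (l i.castSucc - d i) * (d i - l i.succ) :=
    mul_nonneg (sub_nonneg.2 (hl i).1) (sub_nonneg.2 (hl i).2)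
  calc (0 : ℝ) ≤ _ := mul_nonneg h1 h
    _ = _ := by ring

open Polynomial in
theorem exists_partial_fraction_of_strictAnti {k : ℕ} {d : Fin k → ℝ} {l : Fin (k + 1) → ℝ}
    (hd : StrictAnti d) (hl : ∀ i : Fin k, d i ≤ l i.castSucc ∧ l i.succ ≤ d i) :
    ∃ (a : ℝ) (c : Fin k → ℝ), (∀ i, 0 ≤ c i) ∧ ∀ z : ℝ, (∀ i, z ≠ d i) →
      ∏ i, (z - l i) = (∏ i, (z - d i)) * (z - a - ∑ i, c i / (z - d i)) := by
  set q : ℝ[X] := Lagrange.nodal univ d with hq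
  set p : ℝ[X] := Lagrange.nodal univ l with hp
  have hqm : q.Monic := Lagrange.nodal_monic
  have hpm : p.Monic := Lagrange.nodal_monic
  have hqd : q.natDegree = k := by simp [hq]
  have hpd : p.natDegree = k + 1 := by simp [hp]
  have hdiv : (p /ₘ q).natDegree = 1 := by
    rw [natDegree_divByMonic _ hqm, hqd, hpd]
    simp
  have hdivm : (p /ₘ q).Monic := by
    rw [Monic, leadingCoeff_divByMonic_of_monic hqm, hpm.leadingCoeff]
    rw [degree_eq_natDegree hqm.ne_zero, degree_eq_natDegree hpm.ne_zero, hqd, hpd]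
    exact_mod_cast Nat.le_succ k
  have hmod : p %ₘ q = Lagrange.interpolate univ d (fun i => p.eval (d i)) := by
    refine Lagrange.eq_interpolate_of_eval_eq _ hd.injective.injOn ?_ fun i _ => ?_
    · have := degree_modByMonic_lt p hqm
      rwa [degree_eq_natDegree hqm.ne_zero, hqd, ← Fintype.card_fin k] at this
    · conv_rhs => rw [← modByMonic_add_div p q]
      simp [hq, Lagrange.eval_nodal_at_node (mem_univ i)]
  refine ⟨-(p /ₘ q).coeff 0,
    fun i => -((∏ j ∈ univ.erase i, (d i - d j)⁻¹) * ∏ j, (d i - l j)),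
    residue_nonneg hd hl, fun z hz => ?_⟩
  have h1 : p.eval z = (p %ₘ q).eval z + q.eval z * (p /ₘ q).eval z := by
    conv_lhs => rw [← modByMonic_add_div p q]
    simp
  have h2 : (p /ₘ q).eval z = z + (p /ₘ q).coeff 0 := by
    conv_lhs => rw [hdivm.eq_X_add_C hdiv]
    simp
  rw [hmod, h2, Lagrange.eval_interpolate_not_at_node _ (fun i _ => hz i)] at h1
  simp only [hp, hq, Lagrange.eval_nodal, Lagrange.nodalWeight] at h1
  rw [h1, ← mul_add]
  congr 1
  have h3 : ∀ i, -((∏ j ∈ univ.erase i, (d i - d j)⁻¹) * ∏ j, (d i - l j)) / (z - d i) =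
      -((∏ j ∈ univ.erase i, (d i - d j)⁻¹) * (z - d i)⁻¹ * ∏ j, (d i - l j)) := fun i => by
    rw [div_eq_mul_inv]
    ring
  simp only [h3, Finset.sum_neg_distrib]
  ring

/-- Interlacing sequences `l`, `d` arise as the zeros and poles of a rational function
`z - a - ∑ i, c i / (z - d i)` with nonnegative residues `c i`. -/
theorem exists_partial_fraction {k : ℕ} {d : Fin k → ℝ} {l : Fin (k + 1) → ℝ}
    (hl : ∀ i : Fin k, d i ≤ l i.castSucc ∧ l i.succ ≤ d i) :
    ∃ (a : ℝ) (c : Fin k → ℝ), (∀ i, 0 ≤ c i) ∧ ∀ z : ℝ, (∀ i, z ≠ d i) →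
      ∏ i, (z - l i) = (∏ i, (z - d i)) * (z - a - ∑ i, c i / (z - d i)) := by
  induction k with
  | zero =>
    exact exists_partial_fraction_of_strictAnti (fun i => i.elim0) hl
  | succ k ih =>
    by_cases hd : StrictAnti d
    · exact exists_partial_fraction_of_strictAnti hd hl
    obtain ⟨i, hi⟩ : ∃ i : Fin k, d i.castSucc = d i.succ := by
      rw [Fin.strictAnti_iff_succ_lt] at hd
      push Not at hd
      obtain ⟨i, hi⟩ := hd
      refine ⟨i, le_antisymm hi ?_⟩
      have h1 := (hl i.succ).1
      have h2 := (hl i.castSucc).2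
      rw [Fin.succ_castSucc] at h2
      exact h1.trans h2
    have hli : l i.succ.castSucc = d i.succ :=
      le_antisymm (by rw [← hi, ← Fin.succ_castSucc]; exact (hl i.castSucc).2) (hl i.succ).1
    obtain ⟨a, c, hc, h⟩ := ih (d := d ∘ i.succ.succAbove)
      (l := l ∘ i.succ.castSucc.succAbove) (by
        intro j
        simp only [Function.comp_apply]
        have hlt : ∀ {m : ℕ} {x y : Fin m}, (x : ℕ) < y → x < y := fun h => h
        have hle : ∀ {m : ℕ} {x y : Fin m}, (x : ℕ) ≤ y → x ≤ y := fun h => h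
        rcases lt_trichotomy j i with hji | rfl | hij
        · rw [Fin.succAbove_of_castSucc_lt i.succ j
              (hlt (by simp only [Fin.val_castSucc, Fin.val_succ]; omega)),
            Fin.succAbove_of_castSucc_lt _ j.castSucc
              (hlt (by simp only [Fin.val_castSucc, Fin.val_succ]; omega)),
            Fin.succAbove_of_castSucc_lt _ j.succ
              (hlt (by simp only [Fin.val_castSucc, Fin.val_succ]; omega))]
          exact hl j.castSucc
        · rw [Fin.succAbove_of_castSucc_lt j.succ j
              (hlt (by simp only [Fin.val_castSucc, Fin.val_succ]; omega)),
            Fin.succAbove_of_castSucc_lt _ j.castSucc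
              (hlt (by simp only [Fin.val_castSucc, Fin.val_succ]; omega)),
            Fin.succAbove_of_le_castSucc _ j.succ (by simp)]
          exact ⟨(hl j.castSucc).1, hi ▸ (hl j.succ).2⟩
        · rw [Fin.succAbove_of_le_castSucc i.succ j
              (hle (by simp only [Fin.val_castSucc, Fin.val_succ]; omega)),
            Fin.succAbove_of_le_castSucc _ j.castSucc
              (hle (by simp only [Fin.val_castSucc, Fin.val_succ]; omega)),
            Fin.succAbove_of_le_castSucc _ j.succ
              (hle (by simp only [Fin.val_castSucc, Fin.val_succ]; omega))]
          exact hl j.succ)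
    refine ⟨a, i.succ.insertNth 0 c, fun j => ?_, fun z hz => ?_⟩
    · rcases Fin.eq_self_or_eq_succAbove i.succ j with rfl | ⟨j, rfl⟩
      · simp
      · simpa using hc j
    · have := h z fun j => hz _
      rw [Fin.prod_univ_succAbove _ i.succ.castSucc,
        Fin.prod_univ_succAbove (fun i => z - d i) i.succ,
        Fin.sum_univ_succAbove _ i.succ, hli, mul_assoc (z - d i.succ)]
      simpa using Or.inl this

theorem eval_charpoly_arrow {k : ℕ} (d w : Fin k → ℂ) (a z : ℂ) (hz : ∀ i, z ≠ d i) :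
    (fromBlocks (diagonal d) (of fun i (_ : PUnit.{1}) => w i) (of fun _ j => w j)
      (of fun _ _ => a)).charpoly.eval z =
      (∏ i, (z - d i)) * (z - a - ∑ i, w i ^ 2 / (z - d i)) := by
  rw [eval_charpoly]
  have hs : (scalar (Fin k ⊕ PUnit.{1})) z - fromBlocks (diagonal d)
      (of fun i (_ : PUnit.{1}) => w i) (of fun _ j => w j) (of fun _ _ => a) =
      fromBlocks (diagonal fun i => z - d i) (of fun i (_ : PUnit.{1}) => -w i)
        (of fun _ j => -w j) (of fun _ _ => z - a) := by
    ext (i | i) (j | j) <;> simp [Matrix.diagonal_apply]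
    split_ifs <;> simp
  let _ : Invertible (diagonal fun i => z - d i) :=
    invertibleOfRightInverse _ (diagonal fun i => (z - d i)⁻¹) (by
      rw [diagonal_mul_diagonal, ← diagonal_one]
      congr 1
      ext i
      exact mul_inv_cancel₀ (sub_ne_zero.2 (hz i)))
  have hinv : ⅟(diagonal fun i => z - d i) = diagonal fun i => (z - d i)⁻¹ := rfl
  rw [hs, det_fromBlocks₁₁, det_diagonal, hinv]
  congr 1
  rw [det_unique]
  simp only [Matrix.sub_apply, Matrix.mul_apply (M := _ * _), mul_diagonal, of_apply]
  congr 1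
  refine Finset.sum_congr rfl fun i _ => ?_
  rw [div_eq_mul_inv]
  ring

open Polynomial in
/-- Converse of Cauchy interlacing: a Hermitian matrix can be bordered so as to have any prescribed
interlacing spectrum. -/
theorem exists_bordered {k : ℕ} {B : Matrix (Fin k) (Fin k) ℂ} (hB : B.IsHermitian)
    {l : Fin (k + 1) → ℝ} (hl : Antitone l)
    (hBl : ∀ i : Fin k, sortedEig hB i ≤ l i.castSucc ∧ l i.succ ≤ sortedEig hB i) :
    ∃ (A : Matrix (Fin (k + 1)) (Fin (k + 1)) ℂ) (hA : A.IsHermitian),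
      A.submatrix Fin.succ Fin.succ = B ∧ sortedEig hA = l := by
  obtain ⟨a, c, hc, hac⟩ := exists_partial_fraction hBl
  obtain ⟨U, hU, hU', hUB⟩ := exists_unitary_diagonal_sortedEig hB
  set d := sortedEig hB with hd
  let w : Fin k → ℂ := fun i => (√(c i) : ℝ)
  have hw : ∀ i, w i ^ 2 = c i := fun i => by
    simp only [w, ← Complex.ofReal_pow, Real.sq_sqrt (hc i)]
  let R : Matrix (Fin k ⊕ PUnit.{1}) (Fin k ⊕ PUnit.{1}) ℂ :=
    fromBlocks (diagonal fun i => (d i : ℂ)) (of fun i _ => w i) (of fun _ j => w j)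
      (of fun _ _ => (a : ℂ))
  let P : Matrix (Fin k ⊕ PUnit.{1}) (Fin k ⊕ PUnit.{1}) ℂ := fromBlocks U 0 0 1
  have hP : Pᴴ * P = 1 := by
    simp [P, fromBlocks_conjTranspose, fromBlocks_multiply, hU]
  have hR : R.IsHermitian := by
    refine IsHermitian.fromBlocks ?_ ?_ ?_
    · exact isHermitian_diagonal_of_self_adjoint _ (by ext i; simp)
    · ext i j
      simp [w]
    · ext i j
      simp
  let e : Fin (k + 1) ≃ Fin k ⊕ PUnit.{1} :=
    (finSuccEquiv k).trans (Equiv.optionEquivSumPUnit (Fin k))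
  have he : ∀ i : Fin k, e i.succ = Sum.inl i := fun i => by simp [e]
  have hA : ((P * R * Pᴴ).submatrix e e).IsHermitian :=
    (isHermitian_mul_mul_conjTranspose P hR).submatrix e
  refine ⟨_, hA, ?_, ?_⟩
  · ext i j
    rw [submatrix_apply, submatrix_apply, he, he, hUB]
    simp [P, R, fromBlocks_conjTranspose, fromBlocks_multiply]
  · refine antitone_eq_of_prod_X_sub_C_eq (sortedEig_antitone hA) hl ?_
    rw [← charpoly_eq_prod_sortedEig]
    have hch : ((P * R * Pᴴ).submatrix e e).charpoly = R.charpoly := by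
      refine (charpoly_reindex e.symm (P * R * Pᴴ)).trans ?_
      rw [charpoly_mul_comm, ← mul_assoc, hP, one_mul]
    rw [hch]
    refine Polynomial.eq_of_infinite_eval_eq _ _ (Set.Infinite.mono ?_
      ((Set.finite_range d).infinite_compl.image Complex.ofReal_injective.injOn))
    rintro _ ⟨z, hz, rfl⟩
    have hz' : ∀ i, z ≠ d i := fun i h => hz ⟨i, h.symm⟩
    have := hac z hz'
    simp only [Set.mem_ofPred_eq]
    rw [eval_charpoly_arrow _ _ _ _ fun i => Complex.ofReal_injective.ne (hz' i), eval_prod]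
    simp only [eval_sub, eval_X, eval_C, hw]
    exact_mod_cast this.symm

theorem corner_self {n : ℕ} (A : Matrix (Fin n) (Fin n) ℂ) : corner n n le_rfl A = A := by
  ext i j
  simp [corner]

theorem submatrix_succ_corner {n k : ℕ} (hk : k + 1 ≤ n) (A : Matrix (Fin n) (Fin n) ℂ) :
    (corner n (k + 1) hk A).submatrix Fin.succ Fin.succ =
      corner n k (Nat.le_of_succ_le hk) A := by
  ext i j
  simp only [corner, submatrix_apply, of_apply, Fin.val_succ]
  congr 2 <;> omega

theorem corner_submatrix_succ {n k : ℕ} (hk : k ≤ n)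
    (A : Matrix (Fin (n + 1)) (Fin (n + 1)) ℂ) :
    corner n k hk (A.submatrix Fin.succ Fin.succ) =
      corner (n + 1) k (Nat.le_succ_of_le hk) A := by
  ext i j
  simp only [corner, submatrix_apply, of_apply, Fin.succ_mk]
  congr 2 <;> omega

theorem GZ_eq_sortedEig {n k : ℕ} {A : Matrix (Fin n) (Fin n) ℂ} (hA : A.IsHermitian)
    (hk : k ≤ n) {C : Matrix (Fin k) (Fin k) ℂ} (hC : C.IsHermitian)
    (h : corner n k hk A = C) (i : Fin k) : GZ n A k (i + 1) = sortedEig hC i := by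
  subst h
  rw [GZ, dif_pos ⟨hA, by omega, by omega, hk⟩]
  rfl

theorem GZ_interlace {n : ℕ} {A : Matrix (Fin n) (Fin n) ℂ} (hA : A.IsHermitian) {i k : ℕ}
    (hi : 1 ≤ i) (hik : i < k) (hk : k ≤ n) :
    GZ n A k i ≥ GZ n A (k - 1) i ∧ GZ n A (k - 1) i ≥ GZ n A k (i + 1) := by
  obtain ⟨m, rfl⟩ : ∃ m, k = m + 1 := ⟨k - 1, by omega⟩
  obtain ⟨j, rfl⟩ : ∃ j, i = j + 1 := ⟨i - 1, by omega⟩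
  have hC := corner_isHermitian hk hA
  have hC' := corner_isHermitian (Nat.le_of_succ_le hk) hA
  have h := sortedEig_interlace hC hC' (submatrix_succ_corner hk A) ⟨j, by omega⟩
  rwa [← GZ_eq_sortedEig hA _ hC rfl, ← GZ_eq_sortedEig hA _ hC rfl,
    ← GZ_eq_sortedEig hA _ hC' rfl] at h

theorem exists_isHermitian_GZ_eq (n : ℕ) (μ : ℕ → ℕ → ℝ)
    (hμ : ∀ i k : ℕ, 1 ≤ i → i < k → k ≤ n →
      μ k i ≥ μ (k - 1) i ∧ μ (k - 1) i ≥ μ k (i + 1)) :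
    ∃ A : Matrix (Fin n) (Fin n) ℂ, A.IsHermitian ∧
      ∀ i k : ℕ, 1 ≤ i → i ≤ k → k ≤ n → GZ n A k i = μ k i := by
  induction n with
  | zero => exact ⟨0, isHermitian_zero, fun i k _ _ _ => by omega⟩
  | succ n ih =>
    obtain ⟨B, hB, hBμ⟩ := ih fun i k hi hik hk => hμ i k hi hik (Nat.le_succ_of_le hk)
    have hl : ∀ i : Fin n, μ n (i + 1) ≤ μ (n + 1) (i + 1) ∧ μ (n + 1) (i + 2) ≤ μ n (i + 1) :=
      fun i => hμ (i + 1) (n + 1) (by omega) (by omega) le_rfl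
    have hBn : ∀ i : Fin n, sortedEig hB i = μ n (i + 1) := fun i => by
      rw [← GZ_eq_sortedEig hB le_rfl hB (corner_self B)]
      exact hBμ _ _ (by omega) (by omega) le_rfl
    obtain ⟨A, hA, hAB, hAμ⟩ := exists_bordered hB (l := fun j => μ (n + 1) (j + 1))
      (Fin.antitone_iff_succ_le.2 fun i => (hl i).2.trans (hl i).1)
      (fun i => by rw [hBn]; exact hl i)
    refine ⟨A, hA, fun i k hi hik hk => ?_⟩
    obtain ⟨j, rfl⟩ : ∃ j, i = j + 1 := ⟨i - 1, by omega⟩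
    rcases Nat.le_succ_iff.1 hk with hk' | rfl
    · rw [← hBμ _ _ hi hik hk']
      have hC := corner_isHermitian hk' hB
      rw [GZ_eq_sortedEig hB hk' hC rfl ⟨j, hik⟩]
      exact GZ_eq_sortedEig hA hk hC (by rw [← hAB, corner_submatrix_succ]) ⟨j, hik⟩
    · rw [GZ_eq_sortedEig hA le_rfl hA (corner_self A) ⟨j, hik⟩, hAμ]

/-- Every triangular array satisfying the interlacing inequalities is
the Gelfand–Zeitlin array of some Hermitian matrix; consequently the image of the
Gelfand–Zeitlin map is exactly the cone cut out by the interlacing inequalities. -/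
theorem statement_2 (n : ℕ) (μ : ℕ → ℕ → ℝ)
    (hμ : ∀ i k : ℕ, 1 ≤ i → i < k → k ≤ n →
      μ k i ≥ μ (k - 1) i ∧ μ (k - 1) i ≥ μ k (i + 1)) :
    (∃ A : Matrix (Fin n) (Fin n) ℂ, A.IsHermitian ∧
      ∀ i k : ℕ, 1 ≤ i → i ≤ k → k ≤ n → GZ n A k i = μ k i) ∧
    (∀ ν : ℕ → ℕ → ℝ,
      (∃ A : Matrix (Fin n) (Fin n) ℂ, A.IsHermitian ∧
        ∀ i k : ℕ, 1 ≤ i → i ≤ k → k ≤ n → GZ n A k i = ν k i) ↔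
      (∀ i k : ℕ, 1 ≤ i → i < k → k ≤ n →
        ν k i ≥ ν (k - 1) i ∧ ν (k - 1) i ≥ ν k (i + 1))) := by
  refine ⟨exists_isHermitian_GZ_eq n μ hμ, fun ν => ⟨?_, exists_isHermitian_GZ_eq n ν⟩⟩
  rintro ⟨A, hA, hν⟩ i k hi hik hk
  rw [← hν i k hi hik.le hk, ← hν i (k - 1) hi (by omega) (by omega),
    ← hν (i + 1) k (by omega) hik hk]
  exact GZ_interlace hA hi hik hk

end
end

section
/- Let (μ_i^{(k)})_{1≤i≤k≤n} be a triangular array of real numbers satisfying the strict interlacing inequalities μ_i^{(k)} > μ_i^{(k−1)} > μ_{i+1}^{(k)} for all 1 ≤ i < k ≤ n. Then the set of real symmetric n×n matrices A with λ_i^{(k)}(A) = μ_i^{(k)} for all 1 ≤ i ≤ k ≤ n is finite and has exactly 2^{n(n−1)/2} elements. -/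
open Matrix Finset Filter

noncomputable section

/-- The matrix obtained from `B` by adjoining a first row and column with
corner entry `a` and remaining entries `v`. -/
def bordered {n : ℕ} (a : ℝ) (v : Fin n → ℝ) (B : Matrix (Fin n) (Fin n) ℝ) :
    Matrix (Fin (n + 1)) (Fin (n + 1)) ℝ :=
  Matrix.of (Fin.cons (Fin.cons a v) fun i => Fin.cons (v i) (B i))

theorem bordered_eq_self {n : ℕ} {A : Matrix (Fin (n + 1)) (Fin (n + 1)) ℝ} (hA : Aᵀ = A) :
    bordered (A 0 0) (fun i => A 0 i.succ) (A.submatrix Fin.succ Fin.succ) = A := by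
  ext i j
  refine Fin.cases ?_ (fun i => ?_) i <;> refine Fin.cases ?_ (fun j => ?_) j <;>
    simp [bordered]
  exact congrFun (congrFun hA i.succ) 0

theorem bordered_transpose {n : ℕ} (a : ℝ) (v : Fin n → ℝ) {B : Matrix (Fin n) (Fin n) ℝ}
    (hB : Bᵀ = B) : (bordered a v B)ᵀ = bordered a v B := by
  ext i j
  refine Fin.cases ?_ (fun i => ?_) i <;> refine Fin.cases ?_ (fun j => ?_) j <;>
    simp [bordered]
  exact congrFun (congrFun hB i) j

theorem trace_bordered {n : ℕ} (a : ℝ) (v : Fin n → ℝ) (B : Matrix (Fin n) (Fin n) ℝ) :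
    (bordered a v B).trace = a + B.trace := by
  simp [Matrix.trace, Fin.sum_univ_succ, bordered]

theorem bordered_eq_reindex {n : ℕ} (a : ℝ) (v : Fin n → ℝ) (B : Matrix (Fin n) (Fin n) ℝ) :
    bordered a v B =
      Matrix.reindex ((finSuccEquiv n).trans ((Equiv.optionEquivSumPUnit.{0} (Fin n)).trans
        (Equiv.sumComm _ _))).symm ((finSuccEquiv n).trans
          ((Equiv.optionEquivSumPUnit.{0} (Fin n)).trans (Equiv.sumComm _ _))).symm
        (Matrix.fromBlocks (Matrix.of fun _ _ => a) (Matrix.replicateRow Unit v)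
          (Matrix.replicateCol Unit v) B) := by
  ext i j
  refine Fin.cases ?_ (fun i => ?_) i <;> refine Fin.cases ?_ (fun j => ?_) j <;>
    simp [bordered]

theorem eval_charpoly_bordered_of_ne {n : ℕ} (a : ℝ) (v : Fin n → ℝ)
    {U B : Matrix (Fin n) (Fin n) ℝ} {e : Fin n → ℝ} (hU : U * Uᵀ = 1)
    (hB : B = U * Matrix.diagonal e * Uᵀ) {x : ℝ} (hx : ∀ i, x ≠ e i) :
    (bordered a v B).charpoly.eval x =
      (x - a) * ∏ i, (x - e i) -
        ∑ i, (Uᵀ *ᵥ v) i ^ 2 * ∏ j ∈ Finset.univ.erase i, (x - e j) := by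
  have hU' : Uᵀ * U = 1 := mul_eq_one_comm.mp hU
  have hx' : ∀ i, x - e i ≠ 0 := fun i => sub_ne_zero.mpr (hx i)
  have hM : Matrix.scalar (Fin n) x - B = U * Matrix.diagonal (fun i => x - e i) * Uᵀ := by
    have h1 : Matrix.diagonal (fun i => x - e i) =
        x • (1 : Matrix (Fin n) (Fin n) ℝ) - Matrix.diagonal e := by
      rw [← Matrix.diagonal_one, ← Matrix.diagonal_smul, Matrix.diagonal_sub]
      simp
    rw [h1, Matrix.mul_sub, Matrix.sub_mul, ← hB]
    rw [Matrix.mul_smul, Matrix.mul_one, Matrix.smul_mul, hU, Matrix.smul_one_eq_diagonal,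
      Matrix.scalar_apply]
  have hdet : (Matrix.scalar (Fin n) x - B).det = ∏ i, (x - e i) := by
    rw [hM, Matrix.det_mul_comm, ← Matrix.mul_assoc, hU', Matrix.one_mul, Matrix.det_diagonal]
  have hinv : (Matrix.scalar (Fin n) x - B) *
      (U * Matrix.diagonal (fun i => (x - e i)⁻¹) * Uᵀ) = 1 := by
    have h1 : Matrix.diagonal (fun i => x - e i) * Matrix.diagonal (fun i => (x - e i)⁻¹) = 1 := by
      rw [Matrix.diagonal_mul_diagonal, ← Matrix.diagonal_one]
      congr 1
      ext i
      exact mul_inv_cancel₀ (hx' i)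
    calc _ = U * (Matrix.diagonal (fun i => x - e i) * (Uᵀ * U) *
          Matrix.diagonal (fun i => (x - e i)⁻¹)) * Uᵀ := by
            rw [hM]; simp only [Matrix.mul_assoc]
      _ = 1 := by rw [hU', Matrix.mul_one, h1, Matrix.mul_one, hU]
  let _ : Invertible (Matrix.scalar (Fin n) x - B) := invertibleOfRightInverse _ _ hinv
  have hblock : Matrix.scalar (Unit ⊕ Fin n) x -
      Matrix.fromBlocks (Matrix.of fun _ _ => a) (Matrix.replicateRow Unit v)
          (Matrix.replicateCol Unit v) B =
      Matrix.fromBlocks (Matrix.of fun _ _ => x - a) (-Matrix.replicateRow Unit v)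
          (-Matrix.replicateCol Unit v) (Matrix.scalar (Fin n) x - B) := by
    ext (i | i) (j | j) <;> simp [Matrix.diagonal_apply]
  have hquad : (Matrix.replicateRow Unit v * (U * Matrix.diagonal (fun i => (x - e i)⁻¹) * Uᵀ) *
      Matrix.replicateCol Unit v) default default = ∑ i, (Uᵀ *ᵥ v) i ^ 2 * (x - e i)⁻¹ := by
    have h1 : Matrix.replicateRow Unit v * (U * Matrix.diagonal (fun i => (x - e i)⁻¹) * Uᵀ) *
        Matrix.replicateCol Unit v = Matrix.replicateRow Unit (Uᵀ *ᵥ v) *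
          Matrix.diagonal (fun i => (x - e i)⁻¹) * Matrix.replicateCol Unit (Uᵀ *ᵥ v) := by
      rw [Matrix.replicateCol_mulVec, Matrix.mulVec_transpose, Matrix.replicateRow_vecMul]
      simp only [Matrix.mul_assoc]
    rw [h1, Matrix.mul_apply]
    refine Finset.sum_congr rfl fun i _ => ?_
    rw [Matrix.mul_diagonal]
    simp only [Matrix.replicateRow_apply, Matrix.replicateCol_apply]
    ring
  rw [bordered_eq_reindex, Matrix.charpoly_reindex, Matrix.eval_charpoly, hblock,
    Matrix.det_fromBlocks₂₂, hdet, invOf_eq_right_inv hinv, Matrix.det_unique]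
  simp only [Matrix.neg_mul, Matrix.mul_neg, neg_neg, Matrix.sub_apply, Matrix.of_apply]
  rw [hquad, mul_sub, mul_comm, Finset.mul_sum]
  congr 1
  refine Finset.sum_congr rfl fun i _ => ?_
  rw [← Finset.mul_prod_erase Finset.univ _ (Finset.mem_univ i)]
  field_simp [hx' i]

theorem eval_charpoly_bordered {n : ℕ} (a : ℝ) (v : Fin n → ℝ)
    {U B : Matrix (Fin n) (Fin n) ℝ} {e : Fin n → ℝ} (hU : U * Uᵀ = 1)
    (hB : B = U * Matrix.diagonal e * Uᵀ) (i : Fin n) :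
    (bordered a v B).charpoly.eval (e i) =
      -((Uᵀ *ᵥ v) i ^ 2 * ∏ j ∈ Finset.univ.erase i, (e i - e j)) := by
  have h : (bordered a v B).charpoly =
      (Polynomial.X - Polynomial.C a) * ∏ i, (Polynomial.X - Polynomial.C (e i)) -
        ∑ i, Polynomial.C ((Uᵀ *ᵥ v) i ^ 2) *
          ∏ j ∈ Finset.univ.erase i, (Polynomial.X - Polynomial.C (e j)) := by
    refine Polynomial.eq_of_infinite_eval_eq _ _ ((Set.finite_range e).infinite_compl.mono ?_)
    intro x hx
    have := eval_charpoly_bordered_of_ne a v hU hB (x := x) fun i hi => hx ⟨i, hi.symm⟩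
    simpa [Polynomial.eval_prod, Polynomial.eval_finsetSum] using this
  rw [h]
  simp only [Polynomial.eval_sub, Polynomial.eval_mul, Polynomial.eval_prod,
    Polynomial.eval_finsetSum, Polynomial.eval_X, Polynomial.eval_C]
  rw [Finset.prod_eq_zero (Finset.mem_univ i) (sub_self _), mul_zero, zero_sub,
    Finset.sum_eq_single i]
  · intro j _ hj
    rw [Finset.prod_eq_zero (i := i) (by simp [hj.symm]) (sub_self _), mul_zero]
  · simp

theorem charpoly_bordered_eq_iff {n : ℕ} (a : ℝ) (v : Fin n → ℝ)
    {U B : Matrix (Fin n) (Fin n) ℝ} {e : Fin n → ℝ} (hU : U * Uᵀ = 1)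
    (hB : B = U * Matrix.diagonal e * Uᵀ) (he : Function.Injective e) {P : Polynomial ℝ}
    (hP : P.Monic) (hPn : P.natDegree = n + 1) :
    (bordered a v B).charpoly = P ↔ a = -P.coeff n - B.trace ∧
      ∀ i, (Uᵀ *ᵥ v) i ^ 2 = -P.eval (e i) / ∏ j ∈ Finset.univ.erase i, (e i - e j) := by
  have hne : ∀ i, ∏ j ∈ Finset.univ.erase i, (e i - e j) ≠ 0 := fun i =>
    Finset.prod_ne_zero_iff.mpr fun j hj =>
      sub_ne_zero.mpr fun h => (Finset.ne_of_mem_erase hj) (he h).symm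
  have htr : a + B.trace = -(bordered a v B).charpoly.coeff n := by
    rw [← trace_bordered a v, Matrix.trace_eq_neg_charpoly_coeff]
    simp
  have hev := eval_charpoly_bordered a v hU hB
  constructor
  · intro h
    rw [h] at htr hev
    refine ⟨by linarith, fun i => ?_⟩
    rw [hev, neg_neg, mul_div_cancel_right₀ _ (hne i)]
  · rintro ⟨ha, hv⟩
    have hm := Matrix.charpoly_monic (bordered a v B)
    have hd : (bordered a v B).charpoly.natDegree = n + 1 := by
      simp [Matrix.charpoly_natDegree_eq_dim]
    refine Polynomial.eq_of_degree_sub_lt_of_eval_index_eq (s := Finset.univ) (v := e)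
      he.injOn ?_ ?_
    · rw [Finset.card_univ, Fintype.card_fin, Polynomial.degree_lt_iff_coeff_zero]
      intro m hmn
      rw [Polynomial.coeff_sub, sub_eq_zero]
      rcases hmn.eq_or_lt with rfl | hmn
      · linarith
      rcases (Nat.succ_le_of_lt hmn).eq_or_lt with rfl | hmn
      · have h1 := hm.coeff_natDegree
        have h2 := hP.coeff_natDegree
        rw [hd] at h1
        rw [hPn] at h2
        exact h1.trans h2.symm
      · rw [Polynomial.coeff_eq_zero_of_natDegree_lt (by omega),
          Polynomial.coeff_eq_zero_of_natDegree_lt (by omega)]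
    · intro i _
      rw [hev, hv, div_mul_cancel₀ _ (hne i), neg_neg]

theorem exists_orthogonal_diagonal {n : ℕ} {B : Matrix (Fin n) (Fin n) ℝ} (hB : Bᵀ = B) :
    ∃ (U : Matrix (Fin n) (Fin n) ℝ) (e : Fin n → ℝ), U * Uᵀ = 1 ∧
      B = U * Matrix.diagonal e * Uᵀ ∧
      B.charpoly = ∏ i, (Polynomial.X - Polynomial.C (e i)) := by
  have hH : B.IsHermitian := by
    rwa [Matrix.IsHermitian, Matrix.conjTranspose_eq_transpose_of_trivial]
  refine ⟨hH.eigenvectorUnitary, hH.eigenvalues, ?_, ?_, hH.charpoly_eq⟩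
  · rw [← Matrix.conjTranspose_eq_transpose_of_trivial, ← Matrix.star_eq_conjTranspose]
    exact Unitary.coe_mul_star_self hH.eigenvectorUnitary
  · rw [← Matrix.conjTranspose_eq_transpose_of_trivial, ← Matrix.star_eq_conjTranspose]
    conv_lhs => rw [hH.spectral_theorem, Unitary.conjStarAlgAut_apply]
    rfl

theorem map_univ_eq_of_prod_X_sub_C_eq {K : Type*} [CommRing K] [IsDomain K] {n : ℕ}
    {f g : Fin n → K} (h : ∏ i, (Polynomial.X - Polynomial.C (f i)) =
      ∏ i, (Polynomial.X - Polynomial.C (g i))) :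
    Multiset.map f Finset.univ.val = Multiset.map g Finset.univ.val := by
  have key : ∀ f : Fin n → K, (∏ i, (Polynomial.X - Polynomial.C (f i))).roots =
      Multiset.map f Finset.univ.val := fun f => by
    rw [← Polynomial.roots_multiset_prod_X_sub_C (Multiset.map f Finset.univ.val),
      Multiset.map_map]
    rfl
  rw [← key, ← key, h]

theorem exists_perm_of_prod_X_sub_C_eq {K : Type*} [CommRing K] [IsDomain K] {n : ℕ}
    {f g : Fin n → K} (hg : Function.Injective g)
    (h : ∏ i, (Polynomial.X - Polynomial.C (f i)) = ∏ i, (Polynomial.X - Polynomial.C (g i))) :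
    ∃ σ : Equiv.Perm (Fin n), f = g ∘ σ := by
  have hm := map_univ_eq_of_prod_X_sub_C_eq h
  have hf : Function.Injective f := by
    have : (Multiset.map f Finset.univ.val).Nodup := by
      rw [hm]; exact Finset.univ.nodup.map hg
    exact fun i j hij => Multiset.inj_on_of_nodup_map this i (Finset.mem_univ i) j
      (Finset.mem_univ j) hij
  have hex : ∀ i, ∃ j, g j = f i := fun i => by
    have : f i ∈ Multiset.map g Finset.univ.val := by
      rw [← hm]; exact Multiset.mem_map_of_mem f (Finset.mem_univ i)
    obtain ⟨j, -, hj⟩ := Multiset.mem_map.mp this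
    exact ⟨j, hj⟩
  choose τ hτ using hex
  have hinj : Function.Injective τ := fun i j hij => hf (by rw [← hτ, ← hτ, hij])
  exact ⟨Equiv.ofBijective τ (Finite.injective_iff_bijective.mp hinj), funext fun i => (hτ i).symm⟩

theorem neg_prod_div_prod_pos_of_interlacing {n : ℕ} {α : Fin (n + 1) → ℝ} {β : Fin n → ℝ}
    (hβ : StrictAnti β) (h₁ : ∀ i, β i < α i.castSucc) (h₂ : ∀ i, α i.succ < β i) (j : Fin n) :
    0 < -(∏ i, (β j - α i)) / ∏ i ∈ Finset.univ.erase j, (β j - β i) := by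
  rw [Fin.prod_univ_succAbove _ j.castSucc, ← Finset.mul_prod_erase Finset.univ _
    (Finset.mem_univ j), Fin.succAbove_castSucc_self, ← neg_mul, mul_div_assoc, mul_div_assoc,
    ← Finset.prod_div_distrib]
  refine mul_pos (by linarith [h₁ j]) (mul_pos (by linarith [h₂ j]) (Finset.prod_pos ?_))
  intro i hi
  rcases lt_or_gt_of_ne (Finset.ne_of_mem_erase hi) with hij | hij
  · rw [Fin.succAbove_of_castSucc_lt _ _ (Fin.castSucc_lt_castSucc_iff.mpr hij)]
    have := hβ hij
    exact div_pos_of_neg_of_neg (by linarith [h₁ i]) (by linarith)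
  · rw [Fin.succAbove_of_le_castSucc _ _ (Fin.castSucc_le_castSucc_iff.mpr hij.le)]
    have := hβ hij
    exact div_pos (by linarith [h₂ i]) (by linarith)

theorem nonempty_sq_eq_equiv {n : ℕ} (a : ℝ) {U : Matrix (Fin n) (Fin n) ℝ} (hU : U * Uᵀ = 1)
    {c : Fin n → ℝ} (hc : ∀ i, 0 < c i) :
    Nonempty ({p : ℝ × (Fin n → ℝ) // p.1 = a ∧ ∀ i, (Uᵀ *ᵥ p.2) i ^ 2 = c i} ≃
      (Fin n → Bool)) := by
  have hU' : Uᵀ * U = 1 := mul_eq_one_comm.mp hU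
  have hs : ∀ i, 0 < √(c i) := fun i => Real.sqrt_pos.mpr (hc i)
  have hcancel : ∀ w, Uᵀ *ᵥ (U *ᵥ w) = w := fun w => by
    rw [Matrix.mulVec_mulVec, hU', Matrix.one_mulVec]
  let s : (Fin n → Bool) → Fin n → ℝ := fun ε i => if ε i then √(c i) else -√(c i)
  have hmem : ∀ ε i, (Uᵀ *ᵥ (U *ᵥ s ε)) i ^ 2 = c i := fun ε i => by
    rw [hcancel]
    by_cases h : ε i <;> simp [s, h, Real.sq_sqrt (hc i).le]
  refine ⟨(Equiv.ofBijective (fun ε => ⟨(a, U *ᵥ s ε), rfl, hmem ε⟩) ⟨?_, ?_⟩).symm⟩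
  · intro ε ε' h
    have h1 : U *ᵥ s ε = U *ᵥ s ε' := congrArg (fun p => p.1.2) h
    have h2 : s ε = s ε' := by rw [← hcancel (s ε), h1, hcancel]
    ext i
    have h3 := congrFun h2 i
    have := hs i
    by_cases h : ε i <;> by_cases h' : ε' i <;> simp [s, h, h'] at h3 ⊢ <;> linarith
  · rintro ⟨⟨b, v⟩, hb, hv⟩
    simp only at hb hv
    refine ⟨fun i => decide (0 < (Uᵀ *ᵥ v) i), Subtype.ext (Prod.ext hb.symm ?_)⟩
    have h1 : s (fun i => decide (0 < (Uᵀ *ᵥ v) i)) = Uᵀ *ᵥ v := by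
      ext i
      by_cases h : 0 < (Uᵀ *ᵥ v) i
      · simp [s, h, ← hv, Real.sqrt_sq h.le]
      · simp [s, h, ← hv, Real.sqrt_sq_eq_abs, abs_of_nonpos (not_lt.mp h)]
    change U *ᵥ s _ = v
    rw [h1, Matrix.mulVec_mulVec, hU, Matrix.one_mulVec]

theorem nonempty_bordered_charpoly_equiv {n : ℕ} {B : Matrix (Fin n) (Fin n) ℝ} (hB : Bᵀ = B)
    {α : Fin (n + 1) → ℝ} {β : Fin n → ℝ}
    (hβ : StrictAnti β) (h₁ : ∀ i, β i < α i.castSucc) (h₂ : ∀ i, α i.succ < β i)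
    (hBβ : B.charpoly = ∏ i, (Polynomial.X - Polynomial.C (β i))) :
    Nonempty ({p : ℝ × (Fin n → ℝ) // (bordered p.1 p.2 B).charpoly =
      ∏ i, (Polynomial.X - Polynomial.C (α i))} ≃ (Fin n → Bool)) := by
  obtain ⟨U, e, hU, hBU, hBe⟩ := exists_orthogonal_diagonal hB
  obtain ⟨σ, rfl⟩ := exists_perm_of_prod_X_sub_C_eq hβ.injective (hBe.symm.trans hBβ)
  have hP : (∏ i, (Polynomial.X - Polynomial.C (α i))).Monic :=
    Polynomial.monic_prod_of_monic _ _ fun i _ => Polynomial.monic_X_sub_C _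
  have hPn : (∏ i, (Polynomial.X - Polynomial.C (α i))).natDegree = n + 1 := by
    simp [Polynomial.natDegree_prod_of_monic _ _ fun i _ => Polynomial.monic_X_sub_C (α i)]
  have key := fun p : ℝ × (Fin n → ℝ) => charpoly_bordered_eq_iff p.1 p.2 hU hBU
    (hβ.injective.comp σ.injective) hP hPn
  obtain ⟨E⟩ := nonempty_sq_eq_equiv
    (-(∏ i, (Polynomial.X - Polynomial.C (α i))).coeff n - B.trace) hU
    (c := fun i => -(∏ i, (Polynomial.X - Polynomial.C (α i))).eval ((β ∘ σ) i) /
      ∏ j ∈ Finset.univ.erase i, ((β ∘ σ) i - (β ∘ σ) j)) fun i => by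
        have h := neg_prod_div_prod_pos_of_interlacing hβ h₁ h₂ (σ i)
        have h' : ∏ j ∈ Finset.univ.erase i, ((β ∘ σ) i - (β ∘ σ) j) =
            ∏ j ∈ Finset.univ.erase (σ i), (β (σ i) - β j) :=
          Finset.prod_equiv σ (by simp) (by simp)
        rw [h']
        simpa [Polynomial.eval_prod] using h
  exact ⟨(Equiv.subtypeEquivRight key).trans E⟩

/-- The inclusion of the last `k` indices into `Fin n`. -/
def lastIdx {n k : ℕ} (hk : k ≤ n) (i : Fin k) : Fin n :=
  ⟨n - k + i, by have := i.isLt; omega⟩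

theorem lastIdx_succ {n k : ℕ} (hk : k ≤ n) :
    lastIdx (hk.trans n.le_succ) = Fin.succ ∘ lastIdx hk := by
  ext i
  simp [lastIdx]
  omega

theorem lastIdx_self (n : ℕ) : lastIdx (le_refl n) = id := by
  ext i
  simp [lastIdx]

/-- Real symmetric matrices all of whose bottom-right `k × k` submatrices have roots of the
characteristic polynomial prescribed by the `k`-th row of `μ`. -/
def gzFiber (n : ℕ) (μ : ℕ → ℕ → ℝ) : Set (Matrix (Fin n) (Fin n) ℝ) :=
  {A | Aᵀ = A ∧ ∀ (k : ℕ) (hk : k ≤ n), (A.submatrix (lastIdx hk) (lastIdx hk)).charpoly =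
    ∏ i : Fin k, (Polynomial.X - Polynomial.C (μ k (i + 1)))}

theorem charpoly_of_mem_gzFiber {n : ℕ} {μ : ℕ → ℕ → ℝ} {A : Matrix (Fin n) (Fin n) ℝ}
    (hA : A ∈ gzFiber n μ) :
    A.charpoly = ∏ i : Fin n, (Polynomial.X - Polynomial.C (μ n (i + 1))) := by
  simpa [lastIdx_self] using hA.2 n le_rfl

theorem bordered_submatrix_succ {n : ℕ} (a : ℝ) (v : Fin n → ℝ) (B : Matrix (Fin n) (Fin n) ℝ) :
    (bordered a v B).submatrix Fin.succ Fin.succ = B := by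
  ext i j
  simp [bordered]

theorem mem_gzFiber_succ_iff {n : ℕ} {μ : ℕ → ℕ → ℝ} {A : Matrix (Fin (n + 1)) (Fin (n + 1)) ℝ}
    (hA : Aᵀ = A) :
    A ∈ gzFiber (n + 1) μ ↔ A.submatrix Fin.succ Fin.succ ∈ gzFiber n μ ∧
      A.charpoly = ∏ i : Fin (n + 1), (Polynomial.X - Polynomial.C (μ (n + 1) (i + 1))) := by
  constructor
  · refine fun h => ⟨⟨?_, fun k hk => ?_⟩, charpoly_of_mem_gzFiber h⟩
    · rw [Matrix.transpose_submatrix, hA]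
    · rw [Matrix.submatrix_submatrix, ← lastIdx_succ]
      exact h.2 k _
  · rintro ⟨h, h'⟩
    refine ⟨hA, fun k hk => ?_⟩
    rcases hk.eq_or_lt with rfl | hk'
    · simpa [lastIdx_self] using h'
    · have := h.2 k (Nat.lt_succ_iff.mp hk')
      rwa [Matrix.submatrix_submatrix, ← lastIdx_succ] at this

/-- A matrix in `gzFiber (n + 1) μ` amounts to one in `gzFiber n μ` together with a border
producing the prescribed characteristic polynomial. -/
def gzFiberSuccEquiv (n : ℕ) (μ : ℕ → ℕ → ℝ) :
    gzFiber (n + 1) μ ≃ Σ B : gzFiber n μ, {p : ℝ × (Fin n → ℝ) //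
      (bordered p.1 p.2 B.1).charpoly =
        ∏ i : Fin (n + 1), (Polynomial.X - Polynomial.C (μ (n + 1) (i + 1)))} where
  toFun A := ⟨⟨A.1.submatrix Fin.succ Fin.succ, ((mem_gzFiber_succ_iff A.2.1).mp A.2).1⟩,
    ⟨(A.1 0 0, fun i => A.1 0 i.succ), by
      simpa only [bordered_eq_self A.2.1] using charpoly_of_mem_gzFiber A.2⟩⟩
  invFun q := ⟨bordered q.2.1.1 q.2.1.2 q.1.1,
    (mem_gzFiber_succ_iff (bordered_transpose _ _ q.1.2.1)).mpr
      ⟨by rw [bordered_submatrix_succ]; exact q.1.2, q.2.2⟩⟩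
  left_inv A := Subtype.ext (bordered_eq_self A.2.1)
  right_inv q := by
    rcases q with ⟨⟨B, hB⟩, ⟨⟨a, v⟩, h⟩⟩
    refine Sigma.subtype_ext (Subtype.ext (bordered_submatrix_succ a v B)) ?_
    simp [bordered]

theorem row_strictAnti {n : ℕ} {μ : ℕ → ℕ → ℝ}
    (hμ : ∀ i k : ℕ, 1 ≤ i → i < k → k ≤ n →
      μ k i > μ (k - 1) i ∧ μ (k - 1) i > μ k (i + 1)) {k : ℕ} (hk : k ≤ n) :
    StrictAnti fun i : Fin k => μ k (i + 1) := by
  have key : ∀ d i : ℕ, i + d + 1 < k → μ k (i + d + 1 + 1) < μ k (i + 1) := by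
    intro d
    induction d with
    | zero =>
      intro i hi
      have := hμ (i + 1) k (by omega) (by omega) hk
      exact this.2.trans this.1
    | succ d ih =>
      intro i hi
      have := hμ (i + d + 1 + 1) k (by omega) (by omega) hk
      exact (this.2.trans this.1).trans (ih i (by omega))
  intro i j hij
  obtain ⟨d, hd⟩ := Nat.exists_eq_add_of_lt (Fin.lt_def.mp hij)
  have := key d i (by omega)
  simpa only [hd] using this

theorem finite_gzFiber_and_card (n : ℕ) (μ : ℕ → ℕ → ℝ)
    (hμ : ∀ i k : ℕ, 1 ≤ i → i < k → k ≤ n →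
      μ k i > μ (k - 1) i ∧ μ (k - 1) i > μ k (i + 1)) :
    Finite (gzFiber n μ) ∧ Nat.card (gzFiber n μ) = 2 ^ (n * (n - 1) / 2) := by
  induction n with
  | zero =>
    have : gzFiber 0 μ = Set.univ := by
      refine Set.eq_univ_of_forall fun A => ⟨Subsingleton.elim _ _, fun k hk => ?_⟩
      obtain rfl := Nat.le_zero.mp hk
      simp [Matrix.charpoly]
    rw [this]
    exact ⟨inferInstance, by simp⟩
  | succ n ih =>
    obtain ⟨_, hcard⟩ := ih fun i k hi hik hk => hμ i k hi hik (by omega)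
    have hE : ∀ B : gzFiber n μ, Nonempty ({p : ℝ × (Fin n → ℝ) //
        (bordered p.1 p.2 B.1).charpoly = ∏ i : Fin (n + 1),
          (Polynomial.X - Polynomial.C (μ (n + 1) (i + 1)))} ≃ (Fin n → Bool)) := fun B =>
      nonempty_bordered_charpoly_equiv B.2.1 (row_strictAnti hμ n.le_succ)
        (fun i => (hμ (i + 1) (n + 1) (by omega) (by omega) le_rfl).1)
        (fun i => (hμ (i + 1) (n + 1) (by omega) (by omega) le_rfl).2)
        (charpoly_of_mem_gzFiber B.2)
    have E := (gzFiberSuccEquiv n μ).trans ((Equiv.sigmaCongrRight fun B => (hE B).some).trans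
      (Equiv.sigmaEquivProd _ _))
    refine ⟨Finite.of_equiv _ E.symm, ?_⟩
    rw [Nat.card_congr E, Nat.card_prod, hcard, Nat.triangle_succ, pow_add]
    simp

theorem eq_of_antitone_of_map_univ_eq {k : ℕ} {f g : Fin k → ℝ} (hf : Antitone f)
    (hg : Antitone g) (h : Multiset.map f Finset.univ.val = Multiset.map g Finset.univ.val) :
    f = g := by
  rw [Fin.univ_val_map, Fin.univ_val_map, Multiset.coe_eq_coe] at h
  exact List.ofFn_injective (h.eq_of_sortedGE hf.sortedGE_ofFn hg.sortedGE_ofFn)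

theorem prod_sortedEig {k : ℕ} {B : Matrix (Fin k) (Fin k) ℂ} (hB : B.IsHermitian) :
    B.charpoly = (∏ i, (Polynomial.X - Polynomial.C (sortedEig hB i))).map Complex.ofRealHom := by
  rw [hB.charpoly_eq, Polynomial.map_prod,
    ← (Fin.revPerm.trans (Tuple.sort hB.eigenvalues)).prod_comp]
  simp [sortedEig]

theorem sortedEig_eq_iff {k : ℕ} {B : Matrix (Fin k) (Fin k) ℂ} (hB : B.IsHermitian)
    {ν : Fin k → ℝ} (hν : Antitone ν) : sortedEig hB = ν ↔
      B.charpoly = (∏ i, (Polynomial.X - Polynomial.C (ν i))).map Complex.ofRealHom := by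
  rw [prod_sortedEig hB]
  refine ⟨by rintro rfl; rfl, fun h => ?_⟩
  exact eq_of_antitone_of_map_univ_eq (sortedEig_antitone hB) hν
    (map_univ_eq_of_prod_X_sub_C_eq
      (Polynomial.map_injective _ Complex.ofRealHom.injective h))

theorem gz_eq_iff_mem_gzFiber {n : ℕ} {μ : ℕ → ℕ → ℝ}
    (hμ : ∀ i k : ℕ, 1 ≤ i → i < k → k ≤ n →
      μ k i > μ (k - 1) i ∧ μ (k - 1) i > μ k (i + 1))
    {A : Matrix (Fin n) (Fin n) ℝ} (hA : Aᵀ = A) :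
    (∀ i k : ℕ, 1 ≤ i → i ≤ k → k ≤ n → GZ n (A.map Complex.ofRealHom) k i = μ k i) ↔
      A ∈ gzFiber n μ := by
  have hH : (A.map Complex.ofRealHom).IsHermitian := by
    ext i j
    simpa using congrFun (congrFun hA i) j
  have key : ∀ (k : ℕ) (hk : k ≤ n),
      (sortedEig (corner_isHermitian hk hH) = fun i : Fin k => μ k (i + 1)) ↔
        (A.submatrix (lastIdx hk) (lastIdx hk)).charpoly =
          ∏ i : Fin k, (Polynomial.X - Polynomial.C (μ k (i + 1))) := by
    intro k hk
    have hc : corner n k hk (A.map Complex.ofRealHom) =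
        (A.submatrix (lastIdx hk) (lastIdx hk)).map Complex.ofRealHom := rfl
    rw [sortedEig_eq_iff _ (row_strictAnti hμ hk).antitone, hc, Matrix.charpoly_map]
    exact (Polynomial.map_injective _ Complex.ofRealHom.injective).eq_iff
  simp only [gzFiber, Set.mem_ofPred_eq, hA, true_and, ← key]
  constructor
  · intro h k hk
    ext i
    have := h (i + 1) k (by omega) (by omega) hk
    rwa [GZ, dif_pos ⟨hH, by omega, by omega, hk⟩] at this
  · intro h i k hi hik hk
    rw [GZ, dif_pos ⟨hH, hi, hik, hk⟩, h k hk]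
    simp only [Nat.sub_add_cancel hi]

/-- If the triangular array `μ` satisfies the strict interlacing
inequalities, then the set of real symmetric `n × n` matrices whose Gelfand–Zeitlin
array is `μ` is finite with exactly `2^(n(n−1)/2)` elements. -/
theorem statement_7 (n : ℕ) (μ : ℕ → ℕ → ℝ)
    (hμ : ∀ i k : ℕ, 1 ≤ i → i < k → k ≤ n →
      μ k i > μ (k - 1) i ∧ μ (k - 1) i > μ k (i + 1)) :
    {A : Matrix (Fin n) (Fin n) ℂ | (∀ i j : Fin n, (A i j).im = 0) ∧ Aᵀ = A ∧
      ∀ i k : ℕ, 1 ≤ i → i ≤ k → k ≤ n → GZ n A k i = μ k i}.Finite ∧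
    {A : Matrix (Fin n) (Fin n) ℂ | (∀ i j : Fin n, (A i j).im = 0) ∧ Aᵀ = A ∧
      ∀ i k : ℕ, 1 ≤ i → i ≤ k → k ≤ n → GZ n A k i = μ k i}.ncard =
        2 ^ (n * (n - 1) / 2) := by
  have himage : {A : Matrix (Fin n) (Fin n) ℂ | (∀ i j : Fin n, (A i j).im = 0) ∧ Aᵀ = A ∧
      ∀ i k : ℕ, 1 ≤ i → i ≤ k → k ≤ n → GZ n A k i = μ k i} =
      (fun A : Matrix (Fin n) (Fin n) ℝ => A.map Complex.ofRealHom) '' gzFiber n μ := by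
    ext A
    constructor
    · rintro ⟨hre, hsymm, hGZ⟩
      have hA : (A.map Complex.re).map Complex.ofRealHom = A := by
        ext i j
        exact Complex.ext (by simp) (by simp [hre])
      refine ⟨A.map Complex.re, (gz_eq_iff_mem_gzFiber hμ ?_).mp (by rwa [hA]), hA⟩
      rw [← Matrix.transpose_map, hsymm]
    · rintro ⟨A, hA, rfl⟩
      refine ⟨fun i j => by simp, ?_, (gz_eq_iff_mem_gzFiber hμ hA.1).mpr hA⟩
      rw [← Matrix.transpose_map, hA.1]
  obtain ⟨hfin, hcard⟩ := finite_gzFiber_and_card n μ hμ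
  rw [himage]
  exact ⟨(Set.toFinite (gzFiber n μ)).image _, by
    rw [Set.ncard_image_of_injective _ (Matrix.map_injective Complex.ofRealHom.injective)]
    exact hcard⟩

end
end
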